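/- arXiv:2308.07803 — 2 statements merged into one kernel-verified Lean document; each statement's English description precedes it below -/
import Mathlib

section
/- Under Assumptions (A1)–(A6), the random normalizing constants C_N := ∫_{√N(Θ−T_N)} π(T_N + u/√N) e^{ω_N(u)} du converge in P-probability to π(θ*)·(2π)^{d/2}·det(V*)^{−1/2} as N → ∞; in particular this limit is strictly positive. -/
open MeasureTheory Filter Matrix

attribute [local instance] Matrix.frobeniusNormedAddCommGroup

theorem abs_dotProduct_mulVec_le_frobenius {n : Type*} [Fintype n] (A : Matrix n n ℝ) (x : n → ℝ) :
    |x ⬝ᵥ A.mulVec x| ≤ ‖A‖ * (x ⬝ᵥ x) := by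
  have hx : 0 ≤ x ⬝ᵥ x := Finset.sum_nonneg fun i _ => mul_self_nonneg (x i)
  have hA : ‖A‖ ^ 2 = ∑ p : n × n, A p.1 p.2 ^ 2 := by
    rw [frobenius_norm_def, ← Real.sqrt_eq_rpow, Real.sq_sqrt (by positivity), Fintype.sum_prod_type]
    simp
  have hxA : x ⬝ᵥ A.mulVec x = ∑ p : n × n, A p.1 p.2 * (x p.1 * x p.2) := by
    simp only [dotProduct, mulVec, Finset.mul_sum, Fintype.sum_prod_type]
    exact Finset.sum_congr rfl fun i _ => Finset.sum_congr rfl fun j _ => by ring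
  have hxx : (x ⬝ᵥ x) ^ 2 = ∑ p : n × n, (x p.1 * x p.2) ^ 2 := by
    simp only [dotProduct, sq, Finset.sum_mul_sum, Fintype.sum_prod_type]
    exact Finset.sum_congr rfl fun i _ => Finset.sum_congr rfl fun j _ => by ring
  refine abs_le_of_sq_le_sq ?_ (by positivity)
  rw [mul_pow, hA, hxA, hxx]
  exact Finset.sum_mul_sq_le_sq_mul_sq _ _ _

theorem Matrix.PosDef.exists_det_ne_zero_eq_transpose_mul_self {n : Type*} [Fintype n] [DecidableEq n]
    {V : Matrix n n ℝ} (hV : V.PosDef) :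
    ∃ B : Matrix n n ℝ, B.det ≠ 0 ∧ V = Bᵀ * B := by
  open scoped MatrixOrder in
  obtain ⟨B, hB⟩ := CStarAlgebra.nonneg_iff_eq_star_mul_self.mp hV.posSemidef.nonneg
  have hB' : V = Bᵀ * B := by rw [hB, star_eq_conjTranspose, conjTranspose_eq_transpose_of_trivial]
  refine ⟨B, fun h => hV.det_pos.ne' ?_, hB'⟩
  rw [hB', det_mul, h, mul_zero]

theorem dotProduct_transpose_mul_self_mulVec {n : Type*} [Fintype n] (B : Matrix n n ℝ)
    (x : n → ℝ) : x ⬝ᵥ (Bᵀ * B).mulVec x = B.mulVec x ⬝ᵥ B.mulVec x := by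
  rw [← mulVec_mulVec, dotProduct_mulVec, vecMul_transpose]

theorem Matrix.PosDef.exists_pos_mul_dotProduct_le {n : Type*} [Fintype n]
    {V : Matrix n n ℝ} (hV : V.PosDef) :
    ∃ c : ℝ, 0 < c ∧ ∀ x : n → ℝ, c * (x ⬝ᵥ x) ≤ x ⬝ᵥ V.mulVec x := by
  classical
  obtain ⟨B, hB, rfl⟩ := hV.exists_det_ne_zero_eq_transpose_mul_self
  set K := ‖(B⁻¹)ᵀ * B⁻¹‖
  have hK : 0 ≤ K := norm_nonneg _
  refine ⟨(K + 1)⁻¹, by positivity, fun x => ?_⟩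
  rw [dotProduct_transpose_mul_self_mulVec]
  have h := (le_abs_self _).trans
    (abs_dotProduct_mulVec_le_frobenius ((B⁻¹)ᵀ * B⁻¹) (B.mulVec x))
  rw [dotProduct_transpose_mul_self_mulVec, mulVec_mulVec,
    nonsing_inv_mul B (isUnit_iff_ne_zero.mpr hB), one_mulVec] at h
  have hBx : 0 ≤ B.mulVec x ⬝ᵥ B.mulVec x := Finset.sum_nonneg fun i _ => mul_self_nonneg _
  rw [inv_mul_le_iff₀ (by positivity)]
  linarith

theorem exp_neg_mul_dotProduct_self_eq_prod {n : Type*} [Fintype n] (b : ℝ) (x : n → ℝ) :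
    Real.exp (-b * (x ⬝ᵥ x)) = ∏ i, Real.exp (-b * x i ^ 2) := by
  simp only [dotProduct, Finset.mul_sum, Real.exp_sum, sq]

theorem integrable_exp_neg_mul_dotProduct_self {n : Type*} [Fintype n] {b : ℝ} (hb : 0 < b) :
    Integrable fun x : n → ℝ => Real.exp (-b * (x ⬝ᵥ x)) := by
  simp only [exp_neg_mul_dotProduct_self_eq_prod]
  exact Integrable.fintype_prod (f := fun _ : n => fun y : ℝ => Real.exp (-b * y ^ 2))
    fun _ => integrable_exp_neg_mul_sq hb

theorem Matrix.PosDef.integral_exp_neg_half_mul_dotProduct_mulVec {d : ℕ}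
    {V : Matrix (Fin d) (Fin d) ℝ} (hV : V.PosDef) :
    ∫ x : Fin d → ℝ, Real.exp (-(1 / 2) * (x ⬝ᵥ V.mulVec x)) =
      (2 * Real.pi) ^ ((d : ℝ) / 2) * V.det ^ (-(1 : ℝ) / 2) := by
  obtain ⟨B, hB, rfl⟩ := hV.exists_det_ne_zero_eq_transpose_mul_self
  have hmap : ∫ x : Fin d → ℝ, Real.exp (-(1 / 2) * (x ⬝ᵥ (Bᵀ * B).mulVec x)) =
      ∫ y, Real.exp (-(1 / 2) * (y ⬝ᵥ y)) ∂(Measure.map (toLin' B) volume) := by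
    have hm : Measurable (toLin' B) := (toLin' B).continuous_of_finiteDimensional.measurable
    rw [integral_map hm.aemeasurable
      (Continuous.aestronglyMeasurable (by simp only [dotProduct]; fun_prop))]
    simp only [dotProduct_transpose_mul_self_mulVec, toLin'_apply]
  have hprod : ∫ y : Fin d → ℝ, Real.exp (-(1 / 2) * (y ⬝ᵥ y)) =
      (2 * Real.pi) ^ ((d : ℝ) / 2) := by
    simp only [exp_neg_mul_dotProduct_self_eq_prod]
    rw [integral_fintype_prod_volume_eq_pow (fun y : ℝ => Real.exp (-(1 / 2) * y ^ 2)),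
      integral_gaussian, Fintype.card_fin, Real.sqrt_eq_rpow, ← Real.rpow_mul_natCast (by positivity)]
    congr 1 <;> ring
  have hdet : (Bᵀ * B).det ^ (-(1 : ℝ) / 2) = |B.det⁻¹| := by
    rw [det_mul, det_transpose, ← sq, ← sq_abs, ← Real.rpow_natCast_mul (abs_nonneg _), abs_inv,
      ← Real.rpow_neg_one]
    norm_num
  rw [hmap, Real.map_matrix_volume_pi_eq_smul_volume_pi hB, integral_smul_measure, hprod, hdet,
    ENNReal.toReal_ofReal (abs_nonneg _), smul_eq_mul, mul_comm]

theorem tendsto_setIntegral_mul_exp_of_quadratic_approx {d : ℕ} {Θ : Set (Fin d → ℝ)}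
    (hΘ : MeasurableSet Θ) {f : (Fin d → ℝ) → ℝ} (hf0 : ∀ θ, 0 ≤ f θ) (hfm : Measurable f)
    (hfi : Integrable f) {x : Fin d → ℝ} (hx : x ∈ interior Θ) (hfx : ContinuousAt f x)
    {V : Matrix (Fin d) (Fin d) ℝ} (hV : V.PosDef) {s : ℕ → ℝ} (hs : Tendsto s atTop atTop)
    {a T : ℕ → Fin d → ℝ} (ha : Tendsto a atTop (nhds x)) (hT : Tendsto T atTop (nhds x))
    {q : ℕ → (Fin d → ℝ) → ℝ} (hq : ∀ k, ContinuousOn (q k) Θ) (K : ℝ)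
    (hin : ∀ η : ℝ, 0 < η → ∃ δ : ℝ, 0 < δ ∧ ∀ᶠ k in atTop, ∀ u, T k + (s k)⁻¹ • u ∈ Θ →
      ‖T k + (s k)⁻¹ • u - a k‖ ≤ δ →
        |q k (T k + (s k)⁻¹ • u) + 1 / 2 * (u ⬝ᵥ V.mulVec u)| ≤ η * (1 + u ⬝ᵥ u))
    (hout : ∀ δ : ℝ, 0 < δ → ∃ ε : ℝ, 0 < ε ∧ ∀ᶠ k in atTop, ∀ θ ∈ Θ,
      δ ≤ ‖θ - a k‖ → q k θ ≤ K - ε * s k ^ 2) :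
    Tendsto (fun k => ∫ u in {u | T k + (s k)⁻¹ • u ∈ Θ},
        f (T k + (s k)⁻¹ • u) * Real.exp (q k (T k + (s k)⁻¹ • u))) atTop
      (nhds (f x * ((2 * Real.pi) ^ ((d : ℝ) / 2) * V.det ^ (-(1 : ℝ) / 2)))) := by
  classical
  obtain ⟨c, hc, hcV⟩ := hV.exists_pos_mul_dotProduct_le
  -- the local scale on which the quadratic approximation and the bound on `f` hold
  obtain ⟨δ₁, hδ₁, hquad⟩ := hin (c / 4) (by positivity)
  obtain ⟨ρ, hρ, hfρ⟩ := Metric.eventually_nhds_iff.mp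
    (hfx.eventually (gt_mem_nhds (lt_add_one (f x))))
  set δ := min δ₁ (ρ / 2)
  have hδ : 0 < δ := by positivity
  obtain ⟨ε, hε, hfar⟩ := hout δ hδ
  set H : ℕ → (Fin d → ℝ) → ℝ := fun k => Θ.indicator fun θ => f θ * Real.exp (q k θ)
  have hH0 : ∀ k θ, 0 ≤ H k θ := fun k =>
    Set.indicator_nonneg fun θ _ => mul_nonneg (hf0 θ) (Real.exp_nonneg _)
  have hH_mem : ∀ k θ, θ ∈ Θ → H k θ = f θ * Real.exp (q k θ) := fun k θ hθ =>
    Set.indicator_of_mem hθ _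
  have hH_notMem : ∀ k θ, θ ∉ Θ → H k θ = 0 := fun k θ hθ => Set.indicator_of_notMem hθ _
  have hHm : ∀ k, Measurable (H k) := fun k => by
    have hqm : Measurable (Θ.piecewise (q k) 0) :=
      (hq k).measurable_piecewise continuousOn_const hΘ
    have hH : H k = Θ.indicator fun θ => f θ * Real.exp (Θ.piecewise (q k) 0 θ) :=
      Set.indicator_congr fun θ hθ => by rw [Set.piecewise_eq_of_mem _ _ _ hθ]
    rw [hH]
    exact (hfm.mul (Real.measurable_exp.comp hqm)).indicator hΘ
  have haff : ∀ k, Measurable fun u : Fin d → ℝ => T k + (s k)⁻¹ • u := fun k => by fun_prop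
  set B : ℕ → Set (Fin d → ℝ) := fun k => Metric.ball (a k) δ
  have hBm : ∀ k, MeasurableSet (B k) := fun k => Metric.isOpen_ball.measurableSet
  have hspos : ∀ᶠ k in atTop, 0 < s k := hs.eventually_gt_atTop 0
  have hconv : ∀ u : Fin d → ℝ, Tendsto (fun k => T k + (s k)⁻¹ • u) atTop (nhds x) := fun u => by
    simpa using hT.add ((tendsto_inv_atTop_zero.comp hs).smul_const u)
  have hconva : ∀ u : Fin d → ℝ,
      Tendsto (fun k => ‖T k + (s k)⁻¹ • u - a k‖) atTop (nhds 0) := fun u => by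
    simpa using ((hconv u).sub ha).norm
  -- a Gaussian bound near the centre
  set bound : (Fin d → ℝ) → ℝ := fun u =>
    (f x + 1) * Real.exp (c / 4) * Real.exp (-(c / 4) * (u ⬝ᵥ u))
  have hbound : Integrable bound :=
    (integrable_exp_neg_mul_dotProduct_self (by positivity)).const_mul _
  have hnear_le : ∀ᶠ k in atTop, ∀ u : Fin d → ℝ,
      ‖(B k).indicator (H k) (T k + (s k)⁻¹ • u)‖ ≤ bound u := by
    filter_upwards [hquad, ha.eventually (Metric.ball_mem_nhds x (half_pos hρ))] with k hk hak u
    have hb0 : 0 ≤ bound u := by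
      have := hf0 x
      positivity
    by_cases hB : T k + (s k)⁻¹ • u ∈ B k
    · by_cases hu : T k + (s k)⁻¹ • u ∈ Θ
      · have hB' : dist (T k + (s k)⁻¹ • u) (a k) < δ := hB
        have hfu : f (T k + (s k)⁻¹ • u) < f x + 1 := by
          apply hfρ
          have h1 : dist (a k) x < ρ / 2 := hak
          have h2 : δ ≤ ρ / 2 := min_le_right _ _
          have := dist_triangle (T k + (s k)⁻¹ • u) (a k) x
          linarith
        have hqu := (abs_le.mp (hk u hu
          ((dist_eq_norm _ _).ge.trans (hB'.le.trans (min_le_left _ _))))).2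
        have hexp : Real.exp (q k (T k + (s k)⁻¹ • u)) ≤
            Real.exp (c / 4) * Real.exp (-(c / 4) * (u ⬝ᵥ u)) := by
          rw [← Real.exp_add, Real.exp_le_exp]
          linarith [hcV u]
        rw [Real.norm_of_nonneg (Set.indicator_nonneg (fun θ _ => hH0 k θ) _),
          Set.indicator_of_mem hB, hH_mem k _ hu]
        calc _ ≤ (f x + 1) * (Real.exp (c / 4) * Real.exp (-(c / 4) * (u ⬝ᵥ u))) :=
              mul_le_mul hfu.le hexp (Real.exp_nonneg _) (by linarith [hf0 x])
          _ = bound u := by simp only [bound]; ring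
      · rw [Set.indicator_of_mem hB, hH_notMem k _ hu, norm_zero]
        exact hb0
    · rw [Set.indicator_of_notMem hB, norm_zero]
      exact hb0
  have hnear_meas : ∀ k, AEStronglyMeasurable
      (fun u => (B k).indicator (H k) (T k + (s k)⁻¹ • u)) volume := fun k =>
    (((hHm k).indicator (hBm k)).comp (haff k)).aestronglyMeasurable
  have hnear : Tendsto (fun k => ∫ u, (B k).indicator (H k) (T k + (s k)⁻¹ • u)) atTop
      (nhds (∫ u, f x * Real.exp (-(1 / 2) * (u ⬝ᵥ V.mulVec u)))) := by
    refine tendsto_integral_filter_of_dominated_convergence bound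
      (Eventually.of_forall hnear_meas) (hnear_le.mono fun k hk => ae_of_all _ hk) hbound
      (ae_of_all _ fun u => ?_)
    have hΘu : ∀ᶠ k in atTop, T k + (s k)⁻¹ • u ∈ Θ :=
      (hconv u).eventually (mem_interior_iff_mem_nhds.mp hx)
    have hq_tendsto : Tendsto (fun k => q k (T k + (s k)⁻¹ • u)) atTop
        (nhds (-(1 / 2) * (u ⬝ᵥ V.mulVec u))) := by
      rw [Metric.tendsto_nhds]
      intro r hr
      have huu : 0 ≤ u ⬝ᵥ u := Finset.sum_nonneg fun i _ => mul_self_nonneg _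
      obtain ⟨δ', hδ', hev⟩ := hin (r / 2 / (1 + u ⬝ᵥ u)) (by positivity)
      filter_upwards [hev, hΘu, (hconva u).eventually (gt_mem_nhds hδ')] with k h1 h2 h3
      have h := h1 u h2 h3.le
      rw [div_mul_cancel₀ _ (by positivity)] at h
      rw [Real.dist_eq, neg_mul, sub_neg_eq_add]
      linarith
    refine (((hfx.tendsto.comp (hconv u)).mul
      ((Real.continuous_exp.tendsto _).comp hq_tendsto))).congr' ?_
    filter_upwards [hΘu, (hconva u).eventually (gt_mem_nhds hδ)] with k h1 h2
    have hB : T k + (s k)⁻¹ • u ∈ B k := by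
      rwa [Metric.mem_ball, dist_eq_norm]
    rw [Set.indicator_of_mem hB, hH_mem k _ h1]
    rfl
  -- the far part is negligible
  have hfar_le : ∀ᶠ k in atTop, ∀ θ,
      (B k)ᶜ.indicator (H k) θ ≤ Real.exp (K - ε * s k ^ 2) * f θ := by
    filter_upwards [hfar] with k hk θ
    have h0 : 0 ≤ Real.exp (K - ε * s k ^ 2) * f θ := mul_nonneg (Real.exp_nonneg _) (hf0 θ)
    by_cases hB : θ ∈ B k
    · rwa [Set.indicator_of_notMem (by simpa using hB)]
    · by_cases hθ : θ ∈ Θ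
      · rw [Set.indicator_of_mem (by simpa using hB), hH_mem k _ hθ, mul_comm]
        refine mul_le_mul_of_nonneg_right (Real.exp_le_exp.mpr (hk θ hθ ?_)) (hf0 θ)
        rw [← dist_eq_norm]
        exact not_lt.mp hB
      · rwa [Set.indicator_of_mem (by simpa using hB), hH_notMem k _ hθ]
  have hf_aff : ∀ k, 0 < s k → Integrable fun u => f (T k + (s k)⁻¹ • u) := fun k hk =>
    (hfi.comp_add_left (T k)).comp_smul (inv_ne_zero hk.ne')
  have hf_int : ∀ k, 0 < s k →
      ∫ u, f (T k + (s k)⁻¹ • u) = s k ^ d * ∫ θ, f θ := fun k hk => by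
    rw [Measure.integral_comp_smul volume (fun u => f (T k + u)), integral_add_left_eq_self,
      Module.finrank_fin_fun, inv_pow, inv_inv, abs_of_pos (pow_pos hk d), smul_eq_mul]
  have hfar_int : ∀ᶠ k in atTop,
      Integrable fun u => (B k)ᶜ.indicator (H k) (T k + (s k)⁻¹ • u) := by
    filter_upwards [hfar_le, hspos] with k hk hsk
    refine ((hf_aff k hsk).const_mul (Real.exp (K - ε * s k ^ 2))).mono'
      (((hHm k).indicator (hBm k).compl).comp (haff k)).aestronglyMeasurable
      (ae_of_all _ fun u => ?_)
    rw [Real.norm_of_nonneg (Set.indicator_nonneg (fun θ _ => hH0 k θ) _)]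
    exact hk _
  have hfar_lim : Tendsto
      (fun k => ∫ u, (B k)ᶜ.indicator (H k) (T k + (s k)⁻¹ • u)) atTop (nhds 0) := by
    have hexp : Tendsto (fun r : ℝ => r ^ d * Real.exp (-(ε * r ^ 2))) atTop (nhds 0) := by
      have h := (Real.tendsto_pow_mul_exp_neg_atTop_nhds_zero d).comp
        (tendsto_id.const_mul_atTop hε)
      have h' := h.const_mul ((ε ^ d)⁻¹)
      rw [mul_zero] at h'
      refine squeeze_zero' ?_ ?_ h'
      · filter_upwards [eventually_ge_atTop 0] with r hr using by positivity
      · filter_upwards [eventually_ge_atTop 1] with r hr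
        have hle : Real.exp (-(ε * r ^ 2)) ≤ Real.exp (-(ε * r)) := by
          rw [Real.exp_le_exp, neg_le_neg_iff]
          exact mul_le_mul_of_nonneg_left (by nlinarith) hε.le
        simp only [Function.comp_apply, id, mul_pow, mul_assoc]
        rw [inv_mul_cancel_left₀ (by positivity)]
        exact mul_le_mul_of_nonneg_left hle (by positivity)
    have hlim := ((hexp.comp hs).const_mul (Real.exp K * ∫ θ, f θ))
    rw [mul_zero] at hlim
    refine squeeze_zero'
      (Eventually.of_forall fun k => integral_nonneg fun u =>
        Set.indicator_nonneg (fun θ _ => hH0 k θ) _) ?_ hlim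
    filter_upwards [hfar_le, hfar_int, hspos] with k h1 h2 h3
    calc _ ≤ ∫ u, Real.exp (K - ε * s k ^ 2) * f (T k + (s k)⁻¹ • u) :=
          integral_mono h2 ((hf_aff k h3).const_mul _) fun u => h1 _
      _ = _ := by
          rw [integral_const_mul, hf_int k h3, sub_eq_add_neg, Real.exp_add]
          simp only [Function.comp_apply]
          ring
  have hsum := hnear.add hfar_lim
  rw [add_zero, integral_const_mul, hV.integral_exp_neg_half_mul_dotProduct_mulVec] at hsum
  refine hsum.congr' ?_
  filter_upwards [hfar_int, hnear_le] with k h1 h2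
  rw [← integral_add (hbound.mono' (hnear_meas k) (ae_of_all _ h2)) h1,
    ← integral_indicator (show MeasurableSet {u | T k + (s k)⁻¹ • u ∈ Θ} from haff k hΘ)]
  refine integral_congr_ae (ae_of_all _ fun u => ?_)
  exact Set.indicator_self_add_compl_apply (B k) (H k) _

theorem quadratic_expansion_recentred {n : Type*} [Fintype n] [DecidableEq n]
    {V : Matrix n n ℝ} (hV : V.IsSymm) (hVu : IsUnit V.det) (R : Matrix n n ℝ) {s : ℝ} (hs : s ≠ 0)
    (G u : n → ℝ) :
    G ⬝ᵥ (s⁻¹ • (u + V⁻¹.mulVec (s⁻¹ • G))) -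
        1 / 2 * ((s⁻¹ • (u + V⁻¹.mulVec (s⁻¹ • G))) ⬝ᵥ
          (s ^ 2 • V + R).mulVec (s⁻¹ • (u + V⁻¹.mulVec (s⁻¹ • G)))) -
        (2 * s ^ 2)⁻¹ * (G ⬝ᵥ V⁻¹.mulVec G) =
      -(1 / 2) * (u ⬝ᵥ V.mulVec u) -
        1 / 2 * ((s ^ 2)⁻¹ * ((u + V⁻¹.mulVec (s⁻¹ • G)) ⬝ᵥ
          R.mulVec (u + V⁻¹.mulVec (s⁻¹ • G)))) := by
  obtain ⟨v, rfl⟩ : ∃ v, G = s • V.mulVec v :=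
    ⟨V⁻¹.mulVec (s⁻¹ • G), by
      rw [mulVec_mulVec, mul_nonsing_inv V hVu, one_mulVec, smul_inv_smul₀ hs]⟩
  have hsymm : v ⬝ᵥ V.mulVec u = u ⬝ᵥ V.mulVec v := by
    rw [dotProduct_comm, dotProduct_mulVec, ← mulVec_transpose, hV.eq]
  have hinv : V⁻¹.mulVec (V.mulVec v) = v := by
    rw [mulVec_mulVec, nonsing_inv_mul V hVu, one_mulVec]
  rw [inv_smul_smul₀ hs]
  simp only [add_mulVec, smul_mulVec, mulVec_smul, mulVec_add, dotProduct_add, add_dotProduct,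
    smul_dotProduct, dotProduct_smul, smul_eq_mul, hinv, hsymm, dotProduct_comm (V.mulVec v)]
  field_simp
  ring

theorem dotProduct_self_add_le {n : Type*} [Fintype n] (u v : n → ℝ) :
    (u + v) ⬝ᵥ (u + v) ≤ 2 * (u ⬝ᵥ u) + 2 * (v ⬝ᵥ v) := by
  have h : 0 ≤ (u - v) ⬝ᵥ (u - v) := Finset.sum_nonneg fun i _ => mul_self_nonneg _
  simp only [sub_dotProduct, dotProduct_sub, add_dotProduct, dotProduct_add] at h ⊢
  linarith

theorem abs_recentred_add_half_dotProduct_mulVec_le {n : Type*} [Fintype n] [DecidableEq n]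
    {V W S : Matrix n n ℝ} (hV : V.IsSymm) (hVu : IsUnit V.det) {s : ℝ} (hs : 0 < s)
    {G u v : n → ℝ} (hv : v = V⁻¹.mulVec (s⁻¹ • G)) {η b : ℝ} (hη : 0 < η) (hb : 0 ≤ b)
    (hvb : v ⬝ᵥ v ≤ b + 1) (hWV : ‖W - V‖ ≤ η) (hS : ‖S‖ ≤ η / (2 * (b + 1)) * s ^ 2) :
    |G ⬝ᵥ (s⁻¹ • (u + v)) -
        1 / 2 * ((s⁻¹ • (u + v)) ⬝ᵥ (s ^ 2 • V + S).mulVec (s⁻¹ • (u + v))) -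
        (2 * s ^ 2)⁻¹ * (G ⬝ᵥ V⁻¹.mulVec G) + 1 / 2 * (u ⬝ᵥ W.mulVec u)| ≤
      η * (1 + u ⬝ᵥ u) := by
  have hid := quadratic_expansion_recentred hV hVu S hs.ne' G u
  rw [← hv] at hid
  have huu : 0 ≤ u ⬝ᵥ u := Finset.sum_nonneg fun i _ => mul_self_nonneg _
  have hhh : 0 ≤ (u + v) ⬝ᵥ (u + v) := Finset.sum_nonneg fun i _ => mul_self_nonneg _
  have hquadV : |u ⬝ᵥ (W - V).mulVec u| ≤ η * (u ⬝ᵥ u) :=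
    (abs_dotProduct_mulVec_le_frobenius _ u).trans (mul_le_mul_of_nonneg_right hWV huu)
  have hquadS : |(s ^ 2)⁻¹ * ((u + v) ⬝ᵥ S.mulVec (u + v))| ≤ η * (1 + u ⬝ᵥ u) := by
    rw [abs_mul, abs_of_pos (by positivity), inv_mul_le_iff₀ (by positivity)]
    refine (abs_dotProduct_mulVec_le_frobenius S _).trans
      ((mul_le_mul_of_nonneg_right hS hhh).trans ?_)
    have hsum : (u + v) ⬝ᵥ (u + v) ≤ 2 * (b + 1) * (1 + u ⬝ᵥ u) := by
      have := dotProduct_self_add_le u v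
      nlinarith [mul_nonneg hb huu]
    calc _ ≤ η / (2 * (b + 1)) * s ^ 2 * (2 * (b + 1) * (1 + u ⬝ᵥ u)) :=
          mul_le_mul_of_nonneg_left hsum (by positivity)
      _ = _ := by field_simp
  rw [hid]
  rw [sub_mulVec, dotProduct_sub] at hquadV
  rw [abs_le] at hquadV hquadS ⊢
  constructor <;> linarith

theorem tendsto_dotProduct {n ι : Type*} [Fintype n] {l : Filter ι} {u v : ι → n → ℝ}
    {u₀ v₀ : n → ℝ} (hu : Tendsto u l (nhds u₀)) (hv : Tendsto v l (nhds v₀)) :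
    Tendsto (fun k => u k ⬝ᵥ v k) l (nhds (u₀ ⬝ᵥ v₀)) :=
  tendsto_finsetSum _ fun j _ => (tendsto_pi_nhds.mp hu j).mul (tendsto_pi_nhds.mp hv j)

theorem tendsto_matrix_mulVec {n ι : Type*} [Fintype n] {l : Filter ι} {A : ι → Matrix n n ℝ}
    {A₀ : Matrix n n ℝ} {v : ι → n → ℝ} {v₀ : n → ℝ} (hA : Tendsto A l (nhds A₀))
    (hv : Tendsto v l (nhds v₀)) :
    Tendsto (fun k => (A k).mulVec (v k)) l (nhds (A₀.mulVec v₀)) := by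
  refine tendsto_pi_nhds.mpr fun i => tendsto_dotProduct (tendsto_pi_nhds.mpr fun j => ?_) hv
  exact ((continuous_id.matrix_elem i j).tendsto A₀).comp hA

theorem tendsto_normalizing_integral_of_seq {d : ℕ} {Θ : Set (Fin d → ℝ)}
    (hΘ : MeasurableSet Θ) {f : (Fin d → ℝ) → ℝ} (hf0 : ∀ θ, 0 ≤ f θ) (hfm : Measurable f)
    (hfi : Integrable f) {x : Fin d → ℝ} (hx : x ∈ interior Θ) (hfx : ContinuousAt f x)
    {Vlim : Matrix (Fin d) (Fin d) ℝ} (hVlim : Vlim.PosDef)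
    {n : ℕ → ℕ} (hn : Tendsto n atTop atTop) {a : ℕ → Fin d → ℝ} (ha : Tendsto a atTop (nhds x))
    {V : ℕ → Matrix (Fin d) (Fin d) ℝ} (hVsymm : ∀ k, (V k).IsSymm)
    (hVunit : ∀ k, IsUnit (V k).det) (hV : Tendsto V atTop (nhds Vlim))
    {G : ℕ → Fin d → ℝ} {g : Fin d → ℝ}
    (hG : Tendsto (fun k => (Real.sqrt (n k))⁻¹ • G k) atTop (nhds g))
    {ℓ : ℕ → (Fin d → ℝ) → ℝ} (hℓ : ∀ k, ContinuousOn (ℓ k) Θ)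
    {R : ℕ → (Fin d → ℝ) → Matrix (Fin d) (Fin d) ℝ}
    (hexpand : ∀ k, ∀ θ ∈ Θ, ℓ k θ = ℓ k (a k) + G k ⬝ᵥ (θ - a k) -
      (1 / 2) * ((θ - a k) ⬝ᵥ ((n k : ℝ) • V k + R k θ).mulVec (θ - a k)))
    (hfar : ∀ δ : ℝ, 0 < δ → ∃ ε : ℝ, 0 < ε ∧ ∀ᶠ k in atTop, ∀ θ ∈ Θ, δ ≤ ‖θ - a k‖ →
      ℓ k θ - ℓ k (a k) ≤ -(ε * n k))
    (hR : ∀ ε : ℝ, 0 < ε → ∃ δ : ℝ, 0 < δ ∧ ∀ᶠ k in atTop, ∀ θ ∈ Θ, ‖θ - a k‖ ≤ δ →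
      ‖R k θ‖ ≤ ε * n k) :
    Tendsto (fun k => ∫ u in {u : Fin d → ℝ |
          (a k + (n k : ℝ)⁻¹ • (V k)⁻¹.mulVec (G k)) + (Real.sqrt (n k))⁻¹ • u ∈ Θ},
        f ((a k + (n k : ℝ)⁻¹ • (V k)⁻¹.mulVec (G k)) + (Real.sqrt (n k))⁻¹ • u) *
          Real.exp (ℓ k ((a k + (n k : ℝ)⁻¹ • (V k)⁻¹.mulVec (G k)) + (Real.sqrt (n k))⁻¹ • u) -
            ℓ k (a k) - (2 * (n k : ℝ))⁻¹ * (G k ⬝ᵥ (V k)⁻¹.mulVec (G k)))) atTop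
      (nhds (f x * ((2 * Real.pi) ^ ((d : ℝ) / 2) * Vlim.det ^ (-(1 : ℝ) / 2)))) := by
  set s : ℕ → ℝ := fun k => Real.sqrt (n k)
  set v : ℕ → Fin d → ℝ := fun k => (V k)⁻¹.mulVec ((s k)⁻¹ • G k)
  have hsq : ∀ k, (n k : ℝ) = s k ^ 2 := fun k => (Real.sq_sqrt (Nat.cast_nonneg _)).symm
  have hs : Tendsto s atTop atTop :=
    Real.tendsto_sqrt_atTop.comp (tendsto_natCast_atTop_atTop.comp hn)
  have hspos : ∀ᶠ k in atTop, 0 < s k := hs.eventually_gt_atTop 0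
  have hVinv : Tendsto (fun k => (V k)⁻¹) atTop (nhds Vlim⁻¹) := by
    refine (continuousAt_matrix_inv Vlim ?_).tendsto.comp hV
    rw [Ring.inverse_eq_inv']
    exact continuousAt_inv₀ hVlim.det_pos.ne'
  have hv : Tendsto v atTop (nhds (Vlim⁻¹.mulVec g)) := tendsto_matrix_mulVec hVinv hG
  have hgv : Tendsto (fun k => ((s k)⁻¹ • G k) ⬝ᵥ v k) atTop (nhds (g ⬝ᵥ Vlim⁻¹.mulVec g)) :=
    tendsto_dotProduct hG hv
  have hvv : Tendsto (fun k => v k ⬝ᵥ v k) atTop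
      (nhds (Vlim⁻¹.mulVec g ⬝ᵥ Vlim⁻¹.mulVec g)) := tendsto_dotProduct hv hv
  have hshift : ∀ k, (n k : ℝ)⁻¹ • (V k)⁻¹.mulVec (G k) = (s k)⁻¹ • v k := fun k => by
    simp only [v]
    rw [mulVec_smul, smul_smul, hsq, sq, mul_inv]
  have hT : Tendsto (fun k => a k + (n k : ℝ)⁻¹ • (V k)⁻¹.mulVec (G k)) atTop (nhds x) := by
    simp only [hshift]
    simpa using ha.add ((tendsto_inv_atTop_zero.comp hs).smul hv)
  refine tendsto_setIntegral_mul_exp_of_quadratic_approx hΘ hf0 hfm hfi hx hfx hVlim hs ha hT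
    (q := fun k θ => ℓ k θ - ℓ k (a k) - (2 * (n k : ℝ))⁻¹ * (G k ⬝ᵥ (V k)⁻¹.mulVec (G k)))
    (fun k => ((hℓ k).sub continuousOn_const).sub continuousOn_const)
    (1 - 1 / 2 * (g ⬝ᵥ Vlim⁻¹.mulVec g)) (fun η hη => ?_) fun δ hδ => ?_
  · set b := Vlim⁻¹.mulVec g ⬝ᵥ Vlim⁻¹.mulVec g
    have hb : 0 ≤ b := Finset.sum_nonneg fun i _ => mul_self_nonneg _
    obtain ⟨δ, hδ, hRδ⟩ := hR (η / (2 * (b + 1))) (by positivity)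
    refine ⟨δ, hδ, ?_⟩
    have hVη : ∀ᶠ k in atTop, ‖Vlim - V k‖ < η := by
      have h : Tendsto (fun k => ‖Vlim - V k‖) atTop (nhds 0) := by
        simpa using (hV.const_sub Vlim).norm
      exact h.eventually (gt_mem_nhds hη)
    filter_upwards [hRδ, hVη, hspos, hvv.eventually (gt_mem_nhds (lt_add_one b))]
      with k hRk hVk hsk hvk u hu hua
    have hdiff : a k + (n k : ℝ)⁻¹ • (V k)⁻¹.mulVec (G k) + (s k)⁻¹ • u - a k =
        (s k)⁻¹ • (u + v k) := by
      rw [hshift, smul_add]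
      abel
    have hRk' := hRk _ hu hua
    rw [hexpand k _ hu, hdiff, add_sub_assoc, add_sub_cancel_left, hsq]
    rw [hsq] at hRk'
    exact abs_recentred_add_half_dotProduct_mulVec_le (hVsymm k) (hVunit k) hsk rfl hη hb hvk.le
      hVk.le hRk'
  · obtain ⟨ε, hε, hev⟩ := hfar δ hδ
    refine ⟨ε, hε, ?_⟩
    filter_upwards [hev, hgv.eventually (lt_mem_nhds (sub_one_lt _))] with k hk hgk θ hθ hθa
    have h := hk θ hθ hθa
    have hG2 : (2 * (n k : ℝ))⁻¹ * (G k ⬝ᵥ (V k)⁻¹.mulVec (G k)) =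
        1 / 2 * (((s k)⁻¹ • G k) ⬝ᵥ v k) := by
      simp only [v]
      rw [mulVec_smul, smul_dotProduct, dotProduct_smul, hsq, smul_eq_mul, smul_eq_mul, mul_inv,
        sq, mul_inv]
      ring
    rw [hG2, ← hsq]
    linarith

theorem measurableSet_setOf_forall_mem_le {Ω E : Type*} [MeasurableSpace Ω] [TopologicalSpace E]
    [SecondCountableTopology E] {S : Set E} {f : Ω → E → ℝ}
    (hf : ∀ θ, Measurable fun ω => f ω θ) (hfc : ∀ ω, ContinuousOn (f ω) S) (c : ℝ) :
    MeasurableSet {ω | ∀ θ ∈ S, f ω θ ≤ c} := by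
  obtain ⟨D, hDc, hD⟩ := TopologicalSpace.exists_countable_dense S
  have h : {ω | ∀ θ ∈ S, f ω θ ≤ c} = ⋂ θ ∈ D, {ω | f ω θ ≤ c} := by
    ext ω
    simp only [Set.mem_ofPred_eq, Set.mem_iInter]
    refine ⟨fun hω θ _ => hω θ θ.2, fun hω θ hθ => ?_⟩
    have hcl : IsClosed {θ : S | f ω θ ≤ c} :=
      isClosed_le (hfc ω).domRestrict continuous_const
    exact hcl.closure_subset_iff.mpr (fun θ hθD => hω θ hθD) (hD ⟨θ, hθ⟩)
  rw [h]
  exact MeasurableSet.biInter hDc fun θ _ => measurableSet_le (hf θ) measurable_const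

theorem tendsto_measure_deviation_of_forall_seq {Ω : Type*} [MeasurableSpace Ω] {P : Measure Ω}
    {A : ℕ → ℕ → Set Ω} (hA : ∀ m, Tendsto (fun N => P (A m N)ᶜ) atTop (nhds 0))
    {C : ℝ → ℕ → Set Ω}
    (hC : ∀ η : ℝ, 0 < η → ∃ M, ∀ᶠ N in atTop, P (C M N)ᶜ ≤ ENNReal.ofReal η)
    {X : ℕ → Ω → ℝ} {c : ℝ}
    (hX : ∀ (M : ℝ) (n : ℕ → ℕ) (ω : ℕ → Ω), Tendsto n atTop atTop →
      (∀ k, ω k ∈ C M (n k)) → (∀ m, ∀ᶠ k in atTop, ω k ∈ A m (n k)) →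
      Tendsto (fun k => X (n k) (ω k)) atTop (nhds c)) {ε : ℝ} (hε : 0 < ε) :
    Tendsto (fun N => P {ω | ε < |X N ω - c|}) atTop (nhds 0) := by
  rw [ENNReal.tendsto_nhds_zero]
  intro η hη
  obtain ⟨r, hr0, hr⟩ := ENNReal.lt_iff_exists_nnreal_btwn.mp (ENNReal.half_pos hη.ne')
  obtain ⟨M, hM⟩ := hC r (by exact_mod_cast hr0)
  rw [ENNReal.ofReal_coe_nnreal] at hM
  obtain ⟨m, hm⟩ : ∃ m, ∀ N ≥ m, ∀ ω ∈ C M N, (∀ j ≤ m, ω ∈ A j N) → |X N ω - c| ≤ ε := by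
    by_contra! hcon
    choose n hnm ω hωC hωA hω using hcon
    have hlim := hX M n ω (tendsto_atTop_mono hnm tendsto_id) hωC
      fun j => (eventually_ge_atTop j).mono fun k hk => hωA k j hk
    obtain ⟨k, hk⟩ := ((Metric.tendsto_nhds.mp hlim) ε hε).exists
    exact (hω k).not_gt hk
  have hsum : Tendsto (fun N => ∑ j ∈ Finset.range (m + 1), P (A j N)ᶜ) atTop (nhds 0) := by
    simpa using tendsto_finsetSum (Finset.range (m + 1)) fun j _ => hA j
  filter_upwards [hM, ENNReal.tendsto_nhds_zero.mp hsum (η / 2) (ENNReal.half_pos hη.ne'),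
    eventually_ge_atTop m] with N h1 h2 h3
  have hsub : {ω | ε < |X N ω - c|} ⊆
      (C M N)ᶜ ∪ ⋃ j ∈ Finset.range (m + 1), (A j N)ᶜ := by
    intro ω hω
    by_contra hnot
    simp only [Set.mem_union, Set.mem_iUnion, Set.mem_compl_iff, Finset.mem_range, not_or,
      not_exists, not_not] at hnot
    exact (hm N h3 ω hnot.1 fun j hj => hnot.2 j (Nat.lt_succ_of_le hj)).not_gt hω
  calc P {ω | ε < |X N ω - c|} ≤ P (C M N)ᶜ + ∑ j ∈ Finset.range (m + 1), P (A j N)ᶜ :=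
        (measure_mono hsub).trans ((measure_union_le _ _).trans
          (add_le_add_right (measure_biUnion_finset_le _ _) _))
    _ ≤ η / 2 + η / 2 := add_le_add (h1.trans hr.le) h2
    _ = η := ENNReal.add_halves η

/-- Under Assumptions (A1)–(A6) of the misspecified Bernstein–von Mises setup,
the random normalizing constants `C_N = ∫_{√N(Θ−T_N)} π(T_N + u/√N) e^{ω_N(u)} du` converge in
`P`-probability to `π(θ*) (2π)^{d/2} det(V*)^{−1/2}` as `N → ∞`; in particular this limit is
strictly positive.  Here `T_N = θ*_N + N⁻¹ V_N⁻¹ G_N` and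
`ω_N(u) = ℓ_N(·, T_N + u/√N) − ℓ_N(·, θ*_N) − (2N)⁻¹ G_Nᵀ V_N⁻¹ G_N`. -/
theorem stmt3 {d : ℕ} {Ω : Type*} [MeasurableSpace Ω] (P : Measure Ω) [IsProbabilityMeasure P]
    (Θ : Set (Fin d → ℝ)) (hΘmeas : MeasurableSet Θ)
    -- misspecified log-likelihoods, measurable in ω, continuous in θ
    (ℓ : ℕ → Ω → (Fin d → ℝ) → ℝ)
    (hℓmeas : ∀ N θ, Measurable fun ω => ℓ N ω θ)
    (hℓcont : ∀ N ω, ContinuousOn (ℓ N ω) Θ)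
    -- the points θ*_N, the scores G_N, the matrices V_N and the remainders R_N
    (θs : ℕ → Fin d → ℝ) (hθsΘ : ∀ N, θs N ∈ Θ)
    (G : ℕ → Ω → Fin d → ℝ) (hGmeas : ∀ N, Measurable (G N))
    (V : ℕ → Matrix (Fin d) (Fin d) ℝ)
    (hVsymm : ∀ N, (V N).IsSymm) (hVunit : ∀ N, IsUnit (V N).det)
    (R : ℕ → Ω → (Fin d → ℝ) → Matrix (Fin d) (Fin d) ℝ)
    (hRsymm : ∀ N ω θ, (R N ω θ).IsSymm)
    (hRmeas : ∀ N θ i j, Measurable fun ω => R N ω θ i j)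
    -- the exact second-order expansion of ℓ_N around θ*_N
    (hexpand : ∀ N ω, ∀ θ ∈ Θ,
      ℓ N ω θ = ℓ N ω (θs N) + G N ω ⬝ᵥ (θ - θs N) -
        (1 / 2) * ((θ - θs N) ⬝ᵥ ((N : ℝ) • V N + R N ω θ).mulVec (θ - θs N)))
    -- the prior density π
    (π : (Fin d → ℝ) → ℝ) (hπnn : ∀ θ, 0 ≤ π θ) (hπmeas : Measurable π)
    (hπdens : ∫ θ, π θ = 1)
    -- (A1)
    (θlim : Fin d → ℝ) (hθlim : θlim ∈ interior Θ)
    (hA1 : Tendsto θs atTop (nhds θlim))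
    -- (A2)
    (Vlim : Matrix (Fin d) (Fin d) ℝ) (hVlimSymm : Vlim.IsSymm) (hVlimPD : Vlim.PosDef)
    (hA2 : Tendsto V atTop (nhds Vlim))
    -- (A3): N^{-1/2} G_N is bounded in P-probability
    (hA3 : ∀ η : ℝ, 0 < η → ∃ M : ℝ,
      limsup (fun N : ℕ => (P {ω | M * Real.sqrt N < ‖G N ω‖}).toReal) atTop < η)
    -- (A4)
    (hA4 : ∀ δ : ℝ, 0 < δ → ∃ ε : ℝ, 0 < ε ∧
      Tendsto (fun N : ℕ => P {ω | ∀ θ ∈ Θ, δ ≤ ‖θ - θs N‖ →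
        ℓ N ω θ - ℓ N ω (θs N) ≤ -(ε * N)}) atTop (nhds 1))
    -- (A5)
    (hA5 : ∀ ε : ℝ, 0 < ε → ∃ δ : ℝ, 0 < δ ∧
      Tendsto (fun N : ℕ => P {ω | ∃ θ ∈ Θ, ‖θ - θs N‖ ≤ δ ∧ ε * N ≤ ‖R N ω θ‖})
        atTop (nhds 0))
    -- (A6)
    (hA6cont : ContinuousAt π θlim) (hA6pos : 0 < π θlim) :
    (0 < π θlim * (2 * Real.pi) ^ ((d : ℝ) / 2) * Vlim.det ^ (-(1 : ℝ) / 2)) ∧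
      ∀ ε : ℝ, 0 < ε →
        Tendsto (fun N : ℕ => P {ω | ε <
          |(∫ u in {u : Fin d → ℝ |
                (θs N + (N : ℝ)⁻¹ • (V N)⁻¹.mulVec (G N ω)) + (Real.sqrt N)⁻¹ • u ∈ Θ},
              π ((θs N + (N : ℝ)⁻¹ • (V N)⁻¹.mulVec (G N ω)) + (Real.sqrt N)⁻¹ • u) *
                Real.exp (ℓ N ω ((θs N + (N : ℝ)⁻¹ • (V N)⁻¹.mulVec (G N ω)) +
                    (Real.sqrt N)⁻¹ • u) - ℓ N ω (θs N) -
                  (2 * (N : ℝ))⁻¹ * (G N ω ⬝ᵥ (V N)⁻¹.mulVec (G N ω)))) -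
            π θlim * (2 * Real.pi) ^ ((d : ℝ) / 2) * Vlim.det ^ (-(1 : ℝ) / 2)|})
          atTop (nhds 0) := by
  classical
  have hπi : Integrable π := by
    by_contra h
    rw [integral_undef h] at hπdens
    exact zero_ne_one hπdens
  refine ⟨mul_pos (mul_pos hA6pos (Real.rpow_pos_of_pos (by positivity) _))
    (Real.rpow_pos_of_pos hVlimPD.det_pos _), fun ε hε => ?_⟩
  have hpos : ∀ m : ℕ, (0 : ℝ) < 1 / ((m : ℝ) + 1) := fun m => Nat.one_div_pos_of_nat
  choose e he hfar using fun m : ℕ => hA4 _ (hpos m)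
  choose r hr hrem using fun m : ℕ => hA5 _ (hpos m)
  set Far : ℕ → ℕ → Set Ω := fun m N => {ω | ∀ θ ∈ Θ, 1 / ((m : ℝ) + 1) ≤ ‖θ - θs N‖ →
    ℓ N ω θ - ℓ N ω (θs N) ≤ -(e m * N)}
  set Rem : ℕ → ℕ → Set Ω := fun m N =>
    {ω | ∃ θ ∈ Θ, ‖θ - θs N‖ ≤ r m ∧ 1 / ((m : ℝ) + 1) * N ≤ ‖R N ω θ‖}
  have hFar_meas : ∀ m N, MeasurableSet (Far m N) := fun m N => by
    have h := measurableSet_setOf_forall_mem_le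
      (S := Θ ∩ {θ | 1 / ((m : ℝ) + 1) ≤ ‖θ - θs N‖})
      (f := fun ω θ => ℓ N ω θ - ℓ N ω (θs N))
      (fun θ => (hℓmeas N θ).sub (hℓmeas N (θs N)))
      (fun ω => ((hℓcont N ω).mono Set.inter_subset_left).sub continuousOn_const) (-(e m * N))
    simpa only [Set.mem_inter_iff, Set.mem_ofPred_eq, and_imp] using h
  have hgood : ∀ m, Tendsto (fun N => P (Far m N ∩ (Rem m N)ᶜ)ᶜ) atTop (nhds 0) := fun m => by
    have hFar_compl : Tendsto (fun N => P (Far m N)ᶜ) atTop (nhds 0) := by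
      simp only [prob_compl_eq_one_sub (hFar_meas m _)]
      rw [← tsub_self (1 : ENNReal)]
      exact ENNReal.Tendsto.sub tendsto_const_nhds (hfar m) (Or.inl ENNReal.one_ne_top)
    have hadd := hFar_compl.add (hrem m)
    rw [add_zero] at hadd
    refine tendsto_of_tendsto_of_tendsto_of_le_of_le tendsto_const_nhds hadd (fun _ => zero_le) fun N => ?_
    rw [Set.compl_inter, compl_compl]
    exact measure_union_le _ _
  have htight : ∀ η : ℝ, 0 < η → ∃ M : ℝ, ∀ᶠ N : ℕ in atTop,
      P {ω | ‖G N ω‖ ≤ M * Real.sqrt N}ᶜ ≤ ENNReal.ofReal η := fun η hη => by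
    obtain ⟨M, hM⟩ := hA3 η hη
    refine ⟨M, ?_⟩
    have hbdd : IsBoundedUnder (· ≤ ·) atTop
        fun N : ℕ => (P {ω | M * Real.sqrt N < ‖G N ω‖}).toReal :=
      isBoundedUnder_of ⟨1, fun N => measureReal_le_one⟩
    filter_upwards [eventually_lt_of_limsup_lt hM hbdd] with N hN
    rw [Set.compl_ofPred]
    simp only [not_le]
    exact (ENNReal.le_ofReal_iff_toReal_le (measure_ne_top _ _) hη.le).mpr hN.le
  refine tendsto_measure_deviation_of_forall_seq hgood htight
    (fun M n ω hn hG hA => tendsto_of_subseq_tendsto fun ns hns => ?_) hε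
  have hbdd : ∀ k, (Real.sqrt (n (ns k)))⁻¹ • G (n (ns k)) (ω (ns k)) ∈
      Metric.closedBall (0 : Fin d → ℝ) |M| := fun k => by
    rw [mem_closedBall_zero_iff, norm_smul, norm_inv, Real.norm_of_nonneg (Real.sqrt_nonneg _)]
    refine inv_mul_le_of_le_mul₀ (Real.sqrt_nonneg _) (abs_nonneg _) ((hG (ns k)).trans ?_)
    rw [mul_comm]
    exact mul_le_mul_of_nonneg_left (le_abs_self M) (Real.sqrt_nonneg _)
  obtain ⟨g, -, φ, hφ, hg⟩ := tendsto_subseq_of_bounded Metric.isBounded_closedBall hbdd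
  refine ⟨φ, ?_⟩
  have hsub : Tendsto (fun k => ns (φ k)) atTop atTop := hns.comp hφ.tendsto_atTop
  have hn' : Tendsto (fun k => n (ns (φ k))) atTop atTop := hn.comp hsub
  rw [mul_assoc]
  refine tendsto_normalizing_integral_of_seq hΘmeas hπnn hπmeas hπi hθlim hA6cont hVlimPD hn'
    (hA1.comp hn') (fun k => hVsymm _) (fun k => hVunit _) (hA2.comp hn') hg
    (fun k => hℓcont _ _) (R := fun k => R (n (ns (φ k))) (ω (ns (φ k))))
    (fun k θ hθ => hexpand _ _ θ hθ) (fun δ hδ => ?_) fun ε' hε' => ?_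
  · obtain ⟨m, hm⟩ := exists_nat_one_div_lt hδ
    refine ⟨e m, he m, ?_⟩
    filter_upwards [hsub.eventually (hA m)] with k hk θ hθ hδθ
    exact hk.1 θ hθ (hm.le.trans hδθ)
  · obtain ⟨m, hm⟩ := exists_nat_one_div_lt hε'
    refine ⟨r m, hr m, ?_⟩
    filter_upwards [hsub.eventually (hA m)] with k hk θ hθ hrθ
    by_contra! hcon
    exact hk.2 ⟨θ, hθ, hrθ, (mul_le_mul_of_nonneg_right hm.le (Nat.cast_nonneg _)).trans hcon.le⟩
end

section
/- Let z > 0 and let B = (B_s)_{s∈[0,z]} be a jointly measurable real-valued stochastic process on a probability space (Ω,𝒜,P) such that for all 0 ≤ r ≤ v ≤ z the random variables B_r and B_v − B_r are independent and Gaussian with mean 0 and variances r and v − r respectively (for example, a standard Brownian motion restricted to [0,z]). Let θ ∈ ℝ and let g, h : [0,z] → ℝ be continuous. Then E[ ( ∫₀^z ( ∫₀^t (B_s − θ)² ds ) g(t) dt ) · ( ∫₀^z ( ∫₀^t (B_s − θ)² ds ) h(t) dt ) ] = ∫₀^z ∫₀^z ( ∫₀^t ∫₀^s [ 3(r∧v)²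 + ((r∨v) − (r∧v))(r∧v) + θ²(5(r∧v) + (r∨v)) + θ⁴ ] dr dv ) g(t) h(s) ds dt; in particular all integrals and expectations above are finite. -/
open MeasureTheory ProbabilityTheory
open scoped NNReal

/-- The first four moments of a centered real Gaussian distribution. -/
lemma integral_pow_gaussianReal_zero (v : ℝ≥0) :
    (∫ x, x ∂gaussianReal 0 v = 0) ∧ (∫ x, x ^ 2 ∂gaussianReal 0 v = v) ∧
    (∫ x, x ^ 3 ∂gaussianReal 0 v = 0) ∧ (∫ x, x ^ 4 ∂gaussianReal 0 v = 3 * (v : ℝ) ^ 2) := by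
  have key (n : ℕ) : ∫ x, x ^ n ∂gaussianReal 0 v
      = iteratedDeriv n (fun t : ℝ ↦ Real.exp (v * t ^ 2 / 2)) 0 := by
    have h := iteratedDeriv_mgf_zero (X := id) (μ := gaussianReal 0 v) (by simp) n
    rw [mgf_id_gaussianReal] at h
    simpa using h.symm
  have hd (p p' : ℝ → ℝ) (hp : ∀ t, HasDerivAt p (p' t) t) :
      deriv (fun t : ℝ ↦ p t * Real.exp (v * t ^ 2 / 2))
        = fun t ↦ (p' t + v * t * p t) * Real.exp (v * t ^ 2 / 2) := by
    ext t
    have h1 : HasDerivAt (fun t : ℝ ↦ v * t ^ 2 / 2) (v * t) t := by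
      convert! (((hasDerivAt_id t).pow 2).const_mul (v : ℝ)).div_const 2 using 1
      simp; ring
    refine ((hp t).mul h1.exp).deriv.trans ?_
    ring
  have e1 : deriv (fun t : ℝ ↦ Real.exp (v * t ^ 2 / 2))
      = fun t ↦ (v * t) * Real.exp (v * t ^ 2 / 2) := by
    simpa using hd (fun _ ↦ 1) (fun _ ↦ 0) (fun t ↦ hasDerivAt_const _ _)
  have e2 := hd (fun t ↦ v * t) (fun _ ↦ v) (fun t ↦ by simpa using (hasDerivAt_id t).const_mul (v : ℝ))
  have e3 := hd (fun t ↦ v + v * t * (v * t)) (fun t ↦ 2 * v ^ 2 * t) (fun t ↦ by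
    convert! (((hasDerivAt_id t).pow 2).const_mul ((v : ℝ) ^ 2)).const_add (v : ℝ) using 1
    · ext x; simp; ring
    · simp; ring)
  have e4 := hd (fun t ↦ 2 * v ^ 2 * t + v * t * (v + v * t * (v * t)))
      (fun t ↦ 3 * v ^ 2 + 3 * v ^ 3 * t ^ 2) (fun t ↦ by
    convert! ((hasDerivAt_id t).const_mul (3 * (v : ℝ) ^ 2)).add
      (((hasDerivAt_id t).pow 3).const_mul ((v : ℝ) ^ 3)) using 1
    · ext x; simp; ring
    · simp; ring)
  refine ⟨?_, ?_, ?_, ?_⟩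
  · simp
  · rw [key]; simp [iteratedDeriv_succ, e1, e2]
  · rw [key]; simp [iteratedDeriv_succ, e1, e2, e3]
  · rw [key]; simp [iteratedDeriv_succ, e1, e2, e3, e4]

lemma integrable_pow_gaussianReal (μ : ℝ) (v : ℝ≥0) (n : ℕ) :
    Integrable (fun x ↦ x ^ n) (gaussianReal μ v) :=
  integrable_pow_of_mem_interior_integrableExpSet (X := fun x ↦ x) (by simp) n

lemma integrable_sub_pow_gaussianReal (θ μ : ℝ) (v : ℝ≥0) (n : ℕ) :
    Integrable (fun x ↦ (x - θ) ^ n) (gaussianReal μ v) := by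
  have h := integrable_pow_gaussianReal (μ - θ) v n
  rw [← gaussianReal_map_sub_const] at h
  exact h.comp_measurable (by fun_prop)

lemma integral_sub_sq_gaussianReal_zero (θ : ℝ) (v : ℝ≥0) :
    ∫ x, (x - θ) ^ 2 ∂gaussianReal 0 v = v + θ ^ 2 := by
  obtain ⟨m1, m2, -, -⟩ := integral_pow_gaussianReal_zero v
  have i (n : ℕ) := integrable_pow_gaussianReal 0 v n
  have e (x : ℝ) : (x - θ) ^ 2 = x ^ 2 + (-2 * θ) * x ^ 1 + θ ^ 2 := by ring
  simp_rw [e]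
  rw [integral_add (by fun_prop) (by fun_prop), integral_add (by fun_prop) (by fun_prop),
    integral_const_mul, m2]
  simp [m1]

lemma integral_sub_pow_four_gaussianReal_zero (θ : ℝ) (v : ℝ≥0) :
    ∫ x, (x - θ) ^ 4 ∂gaussianReal 0 v = 3 * (v : ℝ) ^ 2 + 6 * θ ^ 2 * v + θ ^ 4 := by
  obtain ⟨m1, m2, m3, m4⟩ := integral_pow_gaussianReal_zero v
  have i (n : ℕ) := integrable_pow_gaussianReal 0 v n
  have e (x : ℝ) : (x - θ) ^ 4
      = x ^ 4 + (-4 * θ) * x ^ 3 + (6 * θ ^ 2) * x ^ 2 + (-4 * θ ^ 3) * x ^ 1 + θ ^ 4 := by ring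
  simp_rw [e]
  rw [integral_add (by fun_prop) (by fun_prop), integral_add (by fun_prop) (by fun_prop),
    integral_add (by fun_prop) (by fun_prop), integral_add (by fun_prop) (by fun_prop),
    integral_const_mul, integral_const_mul, integral_const_mul, m2, m3, m4]
  simp [m1]

/-- Mixed moment of the shifted squares of `X` and `X + W`, for independent centered Gaussian
variables `X` and `W` with variances `a` and `d`. -/
lemma integral_sub_sq_mul_add_sub_sq {Ω : Type*} [MeasurableSpace Ω] {P : Measure Ω}
    [IsProbabilityMeasure P] {X W : Ω → ℝ} (hX : Measurable X) (hW : Measurable W)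
    (hXW : IndepFun X W P) {a d : ℝ≥0} (hXa : P.map X = gaussianReal 0 a)
    (hWd : P.map W = gaussianReal 0 d) (θ : ℝ) :
    Integrable (fun ω ↦ (X ω - θ) ^ 2 * (X ω + W ω - θ) ^ 2) P ∧
    ∫ ω, (X ω - θ) ^ 2 * (X ω + W ω - θ) ^ 2 ∂P
      = 3 * (a : ℝ) ^ 2 + d * a + θ ^ 2 * (6 * a + d) + θ ^ 4 := by
  have iX (n : ℕ) : Integrable (fun ω ↦ (X ω - θ) ^ n) P := by
    have h := integrable_sub_pow_gaussianReal θ 0 a n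
    rw [← hXa] at h
    exact h.comp_measurable hX
  have iW (n : ℕ) : Integrable (fun ω ↦ W ω ^ n) P := by
    have h := integrable_pow_gaussianReal 0 d n
    rw [← hWd] at h
    exact h.comp_measurable hW
  have eX (n : ℕ) : ∫ ω, (X ω - θ) ^ n ∂P = ∫ x, (x - θ) ^ n ∂gaussianReal 0 a := by
    rw [← hXa, integral_map hX.aemeasurable (by fun_prop)]
  have eW (n : ℕ) : ∫ ω, W ω ^ n ∂P = ∫ x, x ^ n ∂gaussianReal 0 d := by
    rw [← hWd, integral_map hW.aemeasurable (by fun_prop)]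
  have ind (m n : ℕ) : IndepFun (fun ω ↦ (X ω - θ) ^ m) (fun ω ↦ W ω ^ n) P :=
    hXW.comp (φ := fun x ↦ (x - θ) ^ m) (ψ := fun x ↦ x ^ n) (by fun_prop) (by fun_prop)
  have iXW (m n : ℕ) : Integrable (fun ω ↦ (X ω - θ) ^ m * W ω ^ n) P :=
    (ind m n).integrable_mul (iX m) (iW n)
  have eXW (m n : ℕ) : ∫ ω, (X ω - θ) ^ m * W ω ^ n ∂P
      = (∫ ω, (X ω - θ) ^ m ∂P) * ∫ ω, W ω ^ n ∂P :=
    (ind m n).integral_mul_eq_mul_integral (iX m).1 (iW n).1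
  have e : (fun ω ↦ (X ω - θ) ^ 2 * (X ω + W ω - θ) ^ 2)
      = fun ω ↦ (X ω - θ) ^ 4 + 2 * ((X ω - θ) ^ 3 * W ω ^ 1) + (X ω - θ) ^ 2 * W ω ^ 2 := by
    ext ω; ring
  have i4 := iX 4
  have i31 := (iXW 3 1).const_mul 2
  have i22 := iXW 2 2
  have i431 : Integrable (fun ω ↦ (X ω - θ) ^ 4 + 2 * ((X ω - θ) ^ 3 * W ω ^ 1)) P := i4.add i31
  obtain ⟨m1, m2, -, -⟩ := integral_pow_gaussianReal_zero d
  rw [e]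
  refine ⟨i431.add i22, ?_⟩
  rw [integral_add i431 i22, integral_add i4 i31, integral_const_mul, eXW, eXW,
    eW, eW, eX, eX, eX, integral_sub_sq_gaussianReal_zero, integral_sub_pow_four_gaussianReal_zero, m2]
  simp only [pow_one, m1]
  ring

lemma intervalIntegral_eq_setIntegral_indicator_mul {t z : ℝ} (ht : t ∈ Set.Ioc 0 z)
    (f : ℝ → ℝ) :
    ∫ s in (0:ℝ)..t, f s = ∫ s in Set.Ioc 0 z, (Set.Iic t).indicator 1 s * f s := by
  have e (s : ℝ) : (Set.Iic t).indicator 1 s * f s = (Set.Iic t).indicator f s := by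
    by_cases hs : s ∈ Set.Iic t <;> simp [hs]
  simp_rw [e]
  rw [intervalIntegral.integral_of_le ht.1.le, setIntegral_indicator measurableSet_Iic,
    Set.Ioc_inter_Iic, min_eq_right ht.2]

/-- The expected product of two iterated integral functionals of a process `q` whose pair moments
`E[q v * q r]` are given by the kernel `k`. -/
lemma integral_mul_integral_of_pair_moment {Ω : Type*} [MeasurableSpace Ω] {P : Measure Ω}
    [IsProbabilityMeasure P] {z : ℝ} (hz : 0 ≤ z) {q : Ω → ℝ → ℝ} {k : ℝ → ℝ → ℝ}
    (hq : Integrable (fun p : Ω × ℝ × ℝ ↦ q p.1 p.2.1 * q p.1 p.2.2)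
      (P.prod ((volume.restrict (Set.Ioc 0 z)).prod (volume.restrict (Set.Ioc 0 z)))))
    (hk : ∀ v ∈ Set.Ioc 0 z, ∀ r ∈ Set.Ioc 0 z, ∫ ω, q ω v * q ω r ∂P = k r v)
    {g h : ℝ → ℝ} (hg : IntegrableOn g (Set.Ioc 0 z)) (hh : IntegrableOn h (Set.Ioc 0 z)) :
    Integrable (fun ω ↦ (∫ t in (0:ℝ)..z, (∫ s in (0:ℝ)..t, q ω s) * g t) *
        (∫ t in (0:ℝ)..z, (∫ s in (0:ℝ)..t, q ω s) * h t)) P ∧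
    (∫ ω, (∫ t in (0:ℝ)..z, (∫ s in (0:ℝ)..t, q ω s) * g t) *
        (∫ t in (0:ℝ)..z, (∫ s in (0:ℝ)..t, q ω s) * h t) ∂P) =
      ∫ t in (0:ℝ)..z, ∫ s in (0:ℝ)..z,
        (∫ v in (0:ℝ)..t, ∫ r in (0:ℝ)..s, k r v) * g t * h s := by
  set μ := volume.restrict (Set.Ioc 0 z) with hμ
  set D : ℝ → ℝ → ℝ := fun t s ↦ (Set.Iic t).indicator 1 s with hD
  have hDm : Measurable (fun p : ℝ × ℝ ↦ D p.1 p.2) := by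
    have : (fun p : ℝ × ℝ ↦ D p.1 p.2) = {p : ℝ × ℝ | p.2 ≤ p.1}.indicator 1 := by
      ext p; simp [hD, Set.indicator_apply]
    rw [this]
    exact measurable_one.indicator (measurableSet_le measurable_snd measurable_fst)
  have hD1 (t s : ℝ) : ‖D t s‖ ≤ 1 := by
    simp only [hD, Set.indicator_apply]
    split_ifs <;> simp
  set Ψ : ℝ × ℝ → Ω → ℝ × ℝ → ℝ := fun x ω y ↦
    (g x.1 * h x.2) * (q ω y.1 * q ω y.2) * (D x.1 y.1 * D x.2 y.2) with hΨ
  have hΨi : Integrable (fun p : (ℝ × ℝ) × Ω × ℝ × ℝ ↦ Ψ p.1 p.2.1 p.2.2)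
      ((μ.prod μ).prod (P.prod (μ.prod μ))) := by
    refine ((hg.mul_prod hh).mul_prod hq).mul_bdd (c := 1) (Measurable.aestronglyMeasurable ?_)
      (ae_of_all _ fun p ↦ ?_)
    · exact (hDm.comp (f := fun p : (ℝ × ℝ) × Ω × ℝ × ℝ ↦ (p.1.1, p.2.2.1)) (by fun_prop)).mul
        (hDm.comp (f := fun p : (ℝ × ℝ) × Ω × ℝ × ℝ ↦ (p.1.2, p.2.2.2)) (by fun_prop))
    · rw [norm_mul]
      exact mul_le_one₀ (hD1 _ _) (norm_nonneg _) (hD1 _ _)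
  have hΨa : Integrable (fun p : ((ℝ × ℝ) × Ω) × ℝ × ℝ ↦ Ψ p.1.1 p.1.2 p.2)
      (((μ.prod μ).prod P).prod (μ.prod μ)) :=
    (measurePreserving_prodAssoc (μ.prod μ) P (μ.prod μ)).integrable_comp_of_integrable hΨi
  have hfun (ω : Ω) (f : ℝ → ℝ) : ∫ t in (0:ℝ)..z, (∫ s in (0:ℝ)..t, q ω s) * f t
      = ∫ t, (∫ s, D t s * q ω s ∂μ) * f t ∂μ := by
    rw [intervalIntegral.integral_of_le hz]
    refine setIntegral_congr_fun measurableSet_Ioc fun t ht ↦ ?_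
    simp only [intervalIntegral_eq_setIntegral_indicator_mul ht, hD, hμ]
  have hprod (ω : Ω) : (∫ t in (0:ℝ)..z, (∫ s in (0:ℝ)..t, q ω s) * g t) *
      (∫ t in (0:ℝ)..z, (∫ s in (0:ℝ)..t, q ω s) * h t)
      = ∫ x, ∫ y, Ψ x ω y ∂(μ.prod μ) ∂(μ.prod μ) := by
    rw [hfun, hfun, ← integral_prod_mul]
    refine integral_congr_ae (ae_of_all _ fun x ↦ ?_)
    simp only
    rw [mul_mul_mul_comm, ← integral_prod_mul, ← integral_mul_const]
    refine integral_congr_ae (ae_of_all _ fun y ↦ ?_)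
    simp only [hΨ]
    ring
  have hI := hΨa.integral_prod_left
  simp_rw [hprod]
  refine ⟨hI.integral_prod_right, ?_⟩
  rw [← integral_integral_swap (f := fun x ω ↦ ∫ y, Ψ x ω y ∂(μ.prod μ)) hI]
  have hval : (fun x : ℝ × ℝ ↦ ∫ ω, ∫ y, Ψ x ω y ∂(μ.prod μ) ∂P) =ᵐ[μ.prod μ]
      fun x ↦ (∫ v in (0:ℝ)..x.1, ∫ r in (0:ℝ)..x.2, k r v) * g x.1 * h x.2 := by
    have hmem : ∀ᵐ x ∂(μ.prod μ), x ∈ Set.Ioc 0 z ×ˢ Set.Ioc 0 z := by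
      rw [hμ, Measure.prod_restrict]
      exact ae_restrict_mem (measurableSet_Ioc.prod measurableSet_Ioc)
    filter_upwards [hΨi.prod_right_ae, hmem] with x hx hxm
    rw [integral_integral_swap (f := fun ω y ↦ Ψ x ω y) hx, integral_prod _ hx.integral_prod_right,
      intervalIntegral_eq_setIntegral_indicator_mul hxm.1, mul_assoc, ← integral_mul_const]
    refine setIntegral_congr_fun measurableSet_Ioc fun v hv ↦ ?_
    simp only
    rw [intervalIntegral_eq_setIntegral_indicator_mul hxm.2, ← integral_const_mul,
      ← integral_mul_const]
    refine setIntegral_congr_fun measurableSet_Ioc fun r hr ↦ ?_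
    simp only [hΨ, hD]
    rw [integral_mul_const, integral_const_mul, hk v hv r hr]
    ring
  rw [integral_congr_ae hval, integral_prod _ (hI.integral_prod_left.congr hval),
    intervalIntegral.integral_of_le hz]
  simp_rw [intervalIntegral.integral_of_le hz]
  rfl

/-- Let `B` be a jointly measurable process on `[0,z]` with independent
Gaussian increments from `0` (a Brownian motion), `θ ∈ ℝ`, and `g, h` continuous on `[0,z]`.
Then the expected product of `∫₀^z (∫₀^t (B_s−θ)² ds) g(t) dt` and the analogous functional
with `h` equals the quadruple integral of the moment kernel
`3(r∧v)² + ((r∨v)−(r∧v))(r∧v) + θ²(5(r∧v)+(r∨v)) + θ⁴` against `g(t)h(s)`; in particular the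
product is `P`-integrable. -/
theorem stmt16 {Ω : Type*} [MeasurableSpace Ω] (P : Measure Ω) [IsProbabilityMeasure P]
    (z : ℝ) (hz : 0 < z) (B : Ω → ℝ → ℝ)
    (hBmeas : Measurable (Function.uncurry B))
    (hB : ∀ r v : ℝ, 0 ≤ r → r ≤ v → v ≤ z →
      (IndepFun (fun ω => B ω r) (fun ω => B ω v - B ω r) P ∧
        P.map (fun ω => B ω r) = gaussianReal 0 r.toNNReal ∧
        P.map (fun ω => B ω v - B ω r) = gaussianReal 0 (v - r).toNNReal))
    (θ : ℝ) (g h : ℝ → ℝ)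
    (hg : ContinuousOn g (Set.Icc 0 z)) (hh : ContinuousOn h (Set.Icc 0 z)) :
    Integrable (fun ω =>
      (∫ t in (0:ℝ)..z, (∫ s in (0:ℝ)..t, (B ω s - θ) ^ 2) * g t) *
        (∫ t in (0:ℝ)..z, (∫ s in (0:ℝ)..t, (B ω s - θ) ^ 2) * h t)) P ∧
    (∫ ω, (∫ t in (0:ℝ)..z, (∫ s in (0:ℝ)..t, (B ω s - θ) ^ 2) * g t) *
        (∫ t in (0:ℝ)..z, (∫ s in (0:ℝ)..t, (B ω s - θ) ^ 2) * h t) ∂P) =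
      ∫ t in (0:ℝ)..z, ∫ s in (0:ℝ)..z,
        (∫ v in (0:ℝ)..t, ∫ r in (0:ℝ)..s,
          (3 * (min r v) ^ 2 + (max r v - min r v) * (min r v) +
            θ ^ 2 * (5 * min r v + max r v) + θ ^ 4)) * g t * h s := by
  set k : ℝ → ℝ → ℝ := fun r v ↦ 3 * (min r v) ^ 2 + (max r v - min r v) * (min r v) +
    θ ^ 2 * (5 * min r v + max r v) + θ ^ 4 with hkdef
  have hBt (t : ℝ) : Measurable (fun ω ↦ B ω t) :=
    hBmeas.comp (measurable_id.prodMk measurable_const)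
  have hle (r v : ℝ) (hr : 0 ≤ r) (hrv : r ≤ v) (hv : v ≤ z) :
      Integrable (fun ω ↦ (B ω r - θ) ^ 2 * (B ω v - θ) ^ 2) P ∧
      ∫ ω, (B ω r - θ) ^ 2 * (B ω v - θ) ^ 2 ∂P = k r v := by
    obtain ⟨hind, h1, h2⟩ := hB r v hr hrv hv
    obtain ⟨hi, he⟩ := integral_sub_sq_mul_add_sub_sq
      (W := fun ω ↦ B ω v - B ω r) (hBt r) ((hBt v).sub (hBt r)) hind h1 h2 θ
    simp only [add_sub_cancel] at hi he
    refine ⟨hi, he.trans ?_⟩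
    simp only [hkdef, Real.coe_toNNReal _ hr, Real.coe_toNNReal _ (sub_nonneg.2 hrv),
      min_eq_left hrv, max_eq_right hrv]
    ring
  have hpair (v : ℝ) (hv : v ∈ Set.Ioc 0 z) (r : ℝ) (hr : r ∈ Set.Ioc 0 z) :
      Integrable (fun ω ↦ (B ω v - θ) ^ 2 * (B ω r - θ) ^ 2) P ∧
      ∫ ω, (B ω v - θ) ^ 2 * (B ω r - θ) ^ 2 ∂P = k r v := by
    rcases le_total r v with hrv | hvr
    · simpa only [mul_comm] using hle r v hr.1.le hrv hv.2
    · have hsymm : k r v = k v r := by simp only [hkdef, min_comm, max_comm]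
      rw [hsymm]
      exact hle v r hv.1.le hvr hr.2
  have hmem : ∀ᵐ x ∂((volume.restrict (Set.Ioc 0 z)).prod (volume.restrict (Set.Ioc 0 z))),
      x ∈ Set.Ioc 0 z ×ˢ Set.Ioc 0 z := by
    rw [Measure.prod_restrict]
    exact ae_restrict_mem (measurableSet_Ioc.prod measurableSet_Ioc)
  have hkint : Integrable (fun y : ℝ × ℝ ↦ k y.2 y.1)
      ((volume.restrict (Set.Ioc 0 z)).prod (volume.restrict (Set.Ioc 0 z))) := by
    have hc : Continuous (fun y : ℝ × ℝ ↦ k y.2 y.1) := by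
      simp only [hkdef]
      fun_prop
    rw [Measure.prod_restrict]
    exact (hc.continuousOn.integrableOn_compact (isCompact_Icc.prod isCompact_Icc)).mono_set
      (Set.prod_mono Set.Ioc_subset_Icc_self Set.Ioc_subset_Icc_self)
  refine integral_mul_integral_of_pair_moment hz.le (q := fun ω s ↦ (B ω s - θ) ^ 2) (k := k) ?_
    (fun v hv r hr ↦ (hpair v hv r hr).2)
    (hg.integrableOn_Icc.mono_set Set.Ioc_subset_Icc_self)
    (hh.integrableOn_Icc.mono_set Set.Ioc_subset_Icc_self)
  have hmeas : Measurable
      (fun p : Ω × ℝ × ℝ ↦ (B p.1 p.2.1 - θ) ^ 2 * (B p.1 p.2.2 - θ) ^ 2) := by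
    have m1 : Measurable (fun p : Ω × ℝ × ℝ ↦ B p.1 p.2.1) :=
      hBmeas.comp (f := fun p : Ω × ℝ × ℝ ↦ (p.1, p.2.1)) (by fun_prop)
    have m2 : Measurable (fun p : Ω × ℝ × ℝ ↦ B p.1 p.2.2) :=
      hBmeas.comp (f := fun p : Ω × ℝ × ℝ ↦ (p.1, p.2.2)) (by fun_prop)
    fun_prop
  refine (integrable_prod_iff' hmeas.aestronglyMeasurable).2 ⟨?_, hkint.congr ?_⟩
  · filter_upwards [hmem] with y hy
    exact (hpair y.1 hy.1 y.2 hy.2).1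
  · filter_upwards [hmem] with y hy
    rw [← (hpair y.1 hy.1 y.2 hy.2).2]
    refine integral_congr_ae (ae_of_all _ fun ω ↦ ?_)
    exact (Real.norm_of_nonneg (by positivity)).symm
end
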